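/- arXiv:2305.08004 — 2 statements merged into one kernel-verified Lean document; each statement's English description precedes it below -/
import Mathlib

section
/- Let H = diag(E₁,…,E_d) ∈ M_d(ℂ) be a real diagonal matrix with E₁ ≤ E₂ ≤ ⋯ ≤ E_d, and let ρ ∈ M_d(ℂ) be a density matrix. Then −Tr([H,ρ]²) ≤ (Tr(ρ²) − 1/d)·(E_d − E₁)². -/
open Matrix Complex
open scoped ComplexOrder

theorem Matrix.IsHermitian.apply_mul_apply_swap {n : Type*} {ρ : Matrix n n ℂ}
    (hρ : ρ.IsHermitian) (i j : n) : ρ i j * ρ j i = (normSq (ρ i j) : ℂ) := by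
  rw [← hρ.apply j i, ← mul_conj]
  rfl

theorem Matrix.IsHermitian.re_trace_mul_self {n : Type*} [Fintype n] {ρ : Matrix n n ℂ}
    (hρ : ρ.IsHermitian) : ((ρ * ρ).trace).re = ∑ i, ∑ j, normSq (ρ i j) := by
  simp [Matrix.trace, Matrix.mul_apply, hρ.apply_mul_apply_swap, -mul_re]

theorem Matrix.diagonal_commutator_apply {n : Type*} [Fintype n] [DecidableEq n]
    (E : n → ℝ) (ρ : Matrix n n ℂ) (i j : n) :
    (diagonal (fun i => (E i : ℂ)) * ρ - ρ * diagonal (fun i => (E i : ℂ))) i j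
      = (E i - E j) * ρ i j := by
  rw [sub_apply, diagonal_mul, mul_diagonal]
  ring

theorem Matrix.IsHermitian.neg_re_trace_sq_commutator_diagonal
    {n : Type*} [Fintype n] [DecidableEq n] (E : n → ℝ) {ρ H : Matrix n n ℂ}
    (hρ : ρ.IsHermitian) (hH : H = diagonal fun i => (E i : ℂ)) :
    (-(((H * ρ - ρ * H) * (H * ρ - ρ * H)).trace)).re
      = ∑ i, ∑ j, (E i - E j) ^ 2 * normSq (ρ i j) := by
  have key : -(((H * ρ - ρ * H) * (H * ρ - ρ * H)).trace)
      = ((∑ i, ∑ j, (E i - E j) ^ 2 * normSq (ρ i j) : ℝ) : ℂ) := by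
    subst hH
    simp only [Matrix.trace, diag_apply, mul_apply (M := _ - _), diagonal_commutator_apply]
    push_cast
    simp only [← Finset.sum_neg_distrib, ← hρ.apply_mul_apply_swap]
    refine Finset.sum_congr rfl fun i _ => Finset.sum_congr rfl fun j _ => ?_
    ring
  rw [key, ofReal_re]

theorem Matrix.inv_card_le_sum_normSq_diag {n : Type*} [Fintype n] [Nonempty n]
    {ρ : Matrix n n ℂ} (hρ : ρ.trace = 1) :
    1 / (Fintype.card n : ℝ) ≤ ∑ i, normSq (ρ i i) := by
  have htr : ∑ i, (ρ i i).re = 1 := by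
    simpa [Matrix.trace] using congrArg Complex.re hρ
  have hcs := sq_sum_le_card_mul_sum_sq (s := Finset.univ) (f := fun i => (ρ i i).re)
  rw [htr, one_pow, Finset.card_univ] at hcs
  have hle : ∑ i, (ρ i i).re ^ 2 ≤ ∑ i, normSq (ρ i i) :=
    Finset.sum_le_sum fun i _ => by
      rw [normSq_apply]
      nlinarith [mul_self_nonneg (ρ i i).im]
  rw [div_le_iff₀' (by exact_mod_cast Fintype.card_pos)]
  exact hcs.trans (by gcongr)

/-- For a real diagonal Hamiltonian with nondecreasing energies
`E₁ ≤ ⋯ ≤ E_d` and any density matrix `ρ`,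
`−Tr([H,ρ]²) ≤ (Tr(ρ²) − 1/d)(E_d − E₁)²`. -/
theorem sqSpeed_le_purity_bound {d : ℕ} (hd : 0 < d)
    (E : Fin d → ℝ) (hE : Monotone E)
    (H ρ : Matrix (Fin d) (Fin d) ℂ)
    (hH : H = Matrix.diagonal fun i => (E i : ℂ))
    (hρ : ρ.PosSemidef) (hTrρ : ρ.trace = 1) :
    (-(((H * ρ - ρ * H) * (H * ρ - ρ * H)).trace)).re
      ≤ (((ρ * ρ).trace).re - 1 / (d : ℝ))
          * (E ⟨d - 1, by omega⟩ - E ⟨0, hd⟩)^2 := by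
  have : Nonempty (Fin d) := ⟨⟨0, hd⟩⟩
  have hdiag := inv_card_le_sum_normSq_diag hTrρ
  rw [Fintype.card_fin] at hdiag
  rw [hρ.isHermitian.neg_re_trace_sq_commutator_diagonal E hH,
    hρ.isHermitian.re_trace_mul_self]
  set Δ := E ⟨d - 1, by omega⟩ - E ⟨0, hd⟩
  have hlo (i : Fin d) : E ⟨0, hd⟩ ≤ E i := hE (Fin.mk_le_of_le_val (Nat.zero_le _))
  have hhi (i : Fin d) : E i ≤ E ⟨d - 1, by omega⟩ :=
    hE (Fin.le_def.2 (Nat.le_sub_one_of_lt i.isLt))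
  calc ∑ i, ∑ j, (E i - E j) ^ 2 * normSq (ρ i j)
      ≤ ∑ i, ∑ j, (normSq (ρ i j) - if i = j then normSq (ρ i j) else 0) * Δ ^ 2 := by
        refine Finset.sum_le_sum fun i _ => Finset.sum_le_sum fun j _ => ?_
        rcases eq_or_ne i j with rfl | hij
        · simp
        · rw [if_neg hij, sub_zero, mul_comm]
          refine mul_le_mul_of_nonneg_left (sq_le_sq' ?_ ?_) (normSq_nonneg _) <;>
            linarith [hlo i, hlo j, hhi i, hhi j]
    _ = (∑ i, ∑ j, normSq (ρ i j) - ∑ i, normSq (ρ i i)) * Δ ^ 2 := by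
        simp only [← Finset.sum_mul, Finset.sum_sub_distrib, Finset.sum_ite_eq,
          Finset.mem_univ, if_true]
    _ ≤ (∑ i, ∑ j, normSq (ρ i j) - 1 / (d : ℝ)) * Δ ^ 2 := by gcongr
end

section
/- Let d = 4, let H = diag(E₁,…,E₄) with E₁ < E₂ < E₃ < E₄, set ω₁₄ := E₄ − E₁ and ω₂₃ := E₃ − E₂, and suppose γ₁ := ω₁₄²/ω₂₃² < 2. Set x₀ := (γ₁ − 1)/(4(3 − γ₁)), κ₁ := 4(1/4 + x₀)² + 2(1/4 − x₀)², and κ₂ := κ₁ + 2(1/4 − x₀)². For κ ∈ [κ₂, 1] and θ₁, θ₂ ∈ ℝ define Ψ₁ := (e₁ + e^{−iθ₁}e₄)/√2, Ψ₂ := (e₂ + e^{−iθ₂}e₃)/√2, and ρ_κ := ((1 + √(2κ−1))/2)|Ψ₁⟩⟨Ψ₁| + ((1 − √(2κ−1))/2)|Ψ₂⟩⟨Ψ₂|. Then ρ_κ is a density matrix with Tr(ρ_κ²) = κ, its squared speed is −Tr([H,ρ_κ]²) = ((1+√(2κ−1))²·ω₁₄² + (1−√(2κ−1))²·ω₂₃²)/8,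 and every density matrix σ ∈ M₄(ℂ) with Tr(σ²) = κ satisfies −Tr([H,σ]²) ≤ −Tr([H,ρ_κ]²). -/
open Matrix Complex
open scoped ComplexOrder

/-- The squared speed of a Hermitian matrix against a real diagonal one. -/
lemma neg_trace_commutator_diagonal_sq {n : Type*} [Fintype n] [DecidableEq n]
    (d : n → ℝ) (A : Matrix n n ℂ) (hA : A.IsHermitian) :
    -(((A * diagonal (fun i => (d i : ℂ)) - diagonal (fun i => (d i : ℂ)) * A)
        * (A * diagonal (fun i => (d i : ℂ)) - diagonal (fun i => (d i : ℂ)) * A)).trace)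
      = ((∑ i, ∑ j, (d i - d j) ^ 2 * normSq (A i j) : ℝ) : ℂ) := by
  simp only [Matrix.trace, Matrix.diag]
  simp only [Matrix.mul_apply (M := A * _ - _), Matrix.sub_apply, Matrix.mul_diagonal,
    Matrix.diagonal_mul]
  push_cast
  rw [← Finset.sum_neg_distrib]
  refine Finset.sum_congr rfl fun i _ => ?_
  rw [← Finset.sum_neg_distrib]
  refine Finset.sum_congr rfl fun j _ => ?_
  rw [← hA.apply j i, normSq_eq_conj_mul_self, Complex.star_def]
  ring

/-- The squared speed of `U diag(l) Uᴴ` under `diag(E)`, expressed in both eigenbases. -/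
lemma sum_sq_sub_mul_normSq_conj {n : Type*} [Fintype n] [DecidableEq n]
    (E l : n → ℝ) (U : Matrix n n ℂ) (h₁ : Uᴴ * U = 1) (h₂ : U * Uᴴ = 1) :
    ∑ i, ∑ j, (E i - E j) ^ 2 * normSq ((U * diagonal (fun i => (l i : ℂ)) * Uᴴ) i j)
      = ∑ i, ∑ j, (l i - l j) ^ 2
          * normSq ((Uᴴ * diagonal (fun i => (E i : ℂ)) * U) i j) := by
  set L : Matrix n n ℂ := diagonal (fun i => (l i : ℂ)) with hL
  set D : Matrix n n ℂ := diagonal (fun i => (E i : ℂ)) with hD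
  have hLh : L.IsHermitian := by
    apply Matrix.isHermitian_diagonal_of_self_adjoint
    ext i; simp
  have hDh : D.IsHermitian := by
    apply Matrix.isHermitian_diagonal_of_self_adjoint
    ext i; simp
  have hA : (U * L * Uᴴ).IsHermitian := isHermitian_mul_mul_conjTranspose U hLh
  have hB : (Uᴴ * D * U).IsHermitian := isHermitian_conjTranspose_mul_mul U hDh
  have e₁ := neg_trace_commutator_diagonal_sq E _ hA
  have e₂ := neg_trace_commutator_diagonal_sq l _ hB
  rw [← hD] at e₁
  rw [← hL] at e₂
  have key : U * L * Uᴴ * D - D * (U * L * Uᴴ)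
      = -(U * (Uᴴ * D * U * L - L * (Uᴴ * D * U)) * Uᴴ) := by
    have c₁ : U * (Uᴴ * D * U * L) * Uᴴ = D * (U * L * Uᴴ) := by
      calc _ = (U * Uᴴ) * D * U * L * Uᴴ := by simp only [Matrix.mul_assoc]
        _ = _ := by rw [h₂]; simp only [Matrix.mul_assoc, Matrix.one_mul]
    have c₂ : U * (L * (Uᴴ * D * U)) * Uᴴ = U * L * Uᴴ * D := by
      calc _ = U * L * Uᴴ * D * (U * Uᴴ) := by simp only [Matrix.mul_assoc]
        _ = _ := by rw [h₂, Matrix.mul_one]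
    rw [Matrix.mul_sub, Matrix.sub_mul, c₁, c₂, neg_sub]
  have tr : ∀ X : Matrix n n ℂ, (-(U * X * Uᴴ) * -(U * X * Uᴴ)).trace = (X * X).trace := by
    intro X
    calc _ = (U * (X * (Uᴴ * U) * X * Uᴴ)).trace := by
          rw [neg_mul_neg]; simp only [Matrix.mul_assoc]
      _ = _ := by
          rw [h₁, Matrix.trace_mul_comm, Matrix.mul_one, Matrix.mul_assoc _ Uᴴ, h₁,
            Matrix.mul_one]
  rw [key, tr] at e₁
  exact_mod_cast e₁.symm.trans e₂

lemma sum_normSq_row {n : Type*} [Fintype n] (A : Matrix n n ℂ) (i : n) :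
    ((∑ j, normSq (A i j) : ℝ) : ℂ) = (A * Aᴴ) i i := by
  simp [Matrix.mul_apply, Complex.mul_conj]

/-- Popoviciu's variance bound for the off-diagonal part of a row of a Hermitian matrix. -/
lemma sum_normSq_row_sub_le {n : Type*} [Fintype n] [DecidableEq n]
    (E : n → ℝ) (lo hi : ℝ) (hlo : ∀ i, lo ≤ E i) (hhi : ∀ i, E i ≤ hi)
    (U : Matrix n n ℂ) (h₁ : Uᴴ * U = 1) (h₂ : U * Uᴴ = 1) (k : n) :
    ∑ j ∈ Finset.univ.erase k, normSq ((Uᴴ * diagonal (fun i => (E i : ℂ)) * U) k j)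
      ≤ (hi - lo) ^ 2 / 4 := by
  set m : ℝ := (lo + hi) / 2 with hm
  set F : n → ℝ := fun i => E i - m with hF
  set G : Matrix n n ℂ := Uᴴ * diagonal (fun i => (F i : ℂ)) * U with hG
  have hGE : G = Uᴴ * diagonal (fun i => (E i : ℂ)) * U - (m : ℂ) • 1 := by
    have : diagonal (fun i => (F i : ℂ))
        = diagonal (fun i => (E i : ℂ)) - (m : ℂ) • (1 : Matrix n n ℂ) := by
      ext i j
      by_cases h : i = j <;> simp [hF, h]
    rw [hG, this, Matrix.mul_sub, Matrix.sub_mul, Matrix.mul_smul, Matrix.smul_mul,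
      Matrix.mul_one, h₁]
  have off : ∑ j ∈ Finset.univ.erase k, normSq ((Uᴴ * diagonal (fun i => (E i : ℂ)) * U) k j)
      = ∑ j ∈ Finset.univ.erase k, normSq (G k j) := by
    refine Finset.sum_congr rfl fun j hj => ?_
    have : k ≠ j := (Finset.ne_of_mem_erase hj).symm
    simp [hGE, this]
  have hGG : G * Gᴴ = Uᴴ * diagonal (fun i => ((F i ^ 2 : ℝ) : ℂ)) * U := by
    have hc : (diagonal (fun i => (F i : ℂ)))ᴴ = diagonal (fun i => (F i : ℂ)) := by
      rw [Matrix.diagonal_conjTranspose]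
      congr 1
      ext i; simp
    calc G * Gᴴ = Uᴴ * diagonal (fun i => (F i : ℂ)) * (U * Uᴴ)
          * diagonal (fun i => (F i : ℂ)) * U := by
          rw [hG, Matrix.conjTranspose_mul, Matrix.conjTranspose_mul, hc,
            Matrix.conjTranspose_conjTranspose]
          simp only [Matrix.mul_assoc]
      _ = _ := by
          rw [h₂, Matrix.mul_one, Matrix.mul_assoc Uᴴ, Matrix.diagonal_mul_diagonal]
          simp only [sq, Complex.ofReal_mul]
  have hrow : ∑ j, normSq (G k j) = ∑ i, F i ^ 2 * normSq (U i k) := by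
    have := sum_normSq_row G k
    rw [hGG, Matrix.mul_apply] at this
    simp only [Matrix.mul_diagonal, Matrix.conjTranspose_apply] at this
    rw [← Complex.ofReal_inj, this]
    push_cast
    refine Finset.sum_congr rfl fun i _ => ?_
    rw [normSq_eq_conj_mul_self, Complex.star_def]
    ring
  have hone : ∑ i, normSq (U i k) = 1 := by
    have := congrFun (congrFun h₁ k) k
    rw [Matrix.mul_apply, Matrix.one_apply_eq] at this
    rw [← Complex.ofReal_inj, Complex.ofReal_one, ← this]
    push_cast
    refine Finset.sum_congr rfl fun i _ => ?_
    rw [normSq_eq_conj_mul_self, Matrix.conjTranspose_apply, Complex.star_def]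
  calc _ = ∑ j ∈ Finset.univ.erase k, normSq (G k j) := off
    _ ≤ ∑ j, normSq (G k j) := Finset.sum_le_sum_of_subset_of_nonneg
          (Finset.erase_subset _ _) fun j _ _ => normSq_nonneg _
    _ = ∑ i, F i ^ 2 * normSq (U i k) := hrow
    _ ≤ ∑ i, (hi - lo) ^ 2 / 4 * normSq (U i k) := by
          refine Finset.sum_le_sum fun i _ =>
            mul_le_mul_of_nonneg_right ?_ (normSq_nonneg _)
          simp only [hF, hm]
          nlinarith [mul_nonneg (sub_nonneg.2 (hlo i)) (sub_nonneg.2 (hhi i))]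
    _ = (hi - lo) ^ 2 / 4 := by rw [← Finset.mul_sum, hone, mul_one]

/-- For an orthogonal projection, the off-diagonal part of each row has squared norm at most
`1/4`. -/
lemma sum_normSq_row_projection_le {n : Type*} [Fintype n] [DecidableEq n]
    (P : Matrix n n ℂ) (hP : P.IsHermitian) (hPP : P * P = P) (k : n) :
    ∑ j ∈ Finset.univ.erase k, normSq (P k j) ≤ 1 / 4 := by
  have h := sum_normSq_row P k
  rw [hP.eq, hPP, ← Finset.add_sum_erase _ _ (Finset.mem_univ k)] at h
  have hre := congrArg Complex.re h
  rw [Complex.ofReal_re] at hre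
  have : (P k k).re ^ 2 ≤ normSq (P k k) := by
    rw [normSq_apply]; nlinarith [sq_nonneg (P k k).im]
  nlinarith [sq_nonneg ((P k k).re - 1 / 2)]

lemma normSq_apply_comm {n : Type*} {A : Matrix n n ℂ} (hA : A.IsHermitian)
    (i j : n) : normSq (A i j) = normSq (A j i) := by
  rw [← hA.apply j i, Complex.star_def, normSq_conj]

/-- A bound for fractional matchings of the complete graph on four vertices with edge weights
`(E i - E j) ^ 2`. -/
lemma fractional_matching_bound (E : Fin 4 → ℝ) (hE : Monotone E) (u : Fin 4 → Fin 4 → ℝ)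
    (hu : ∀ i j, 0 ≤ u i j)
    (r0 : u 0 1 + (u 0 2 + u 0 3) ≤ 4⁻¹) (r2 : u 0 2 + (u 1 2 + u 2 3) ≤ 4⁻¹)
    (r3 : u 0 3 + (u 1 3 + u 2 3) ≤ 4⁻¹) :
    (E 0 - E 1) ^ 2 * u 0 1 + (E 0 - E 2) ^ 2 * u 0 2 + (E 0 - E 3) ^ 2 * u 0 3
        + (E 1 - E 2) ^ 2 * u 1 2 + (E 1 - E 3) ^ 2 * u 1 3 + (E 2 - E 3) ^ 2 * u 2 3
      ≤ ((E 3 - E 0) ^ 2 + (E 2 - E 1) ^ 2) / 4 := by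
  obtain ⟨x, hx⟩ : ∃ x, x = E 1 - E 0 := ⟨_, rfl⟩
  obtain ⟨y, hy⟩ : ∃ y, y = E 2 - E 1 := ⟨_, rfl⟩
  obtain ⟨z, hz⟩ : ∃ z, z = E 3 - E 2 := ⟨_, rfl⟩
  have hx0 : 0 ≤ x := hx ▸ sub_nonneg.2 (hE (by decide))
  have hy0 : 0 ≤ y := hy ▸ sub_nonneg.2 (hE (by decide))
  have hz0 : 0 ≤ z := hz ▸ sub_nonneg.2 (hE (by decide))
  have E1 : E 1 = E 0 + x := by rw [hx]; ring
  have E2 : E 2 = E 0 + x + y := by rw [hx, hy]; ring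
  have E3 : E 3 = E 0 + x + y + z := by rw [hx, hy, hz]; ring
  rw [E1, E2, E3]
  have hxy := mul_nonneg hx0 hy0
  have hxz := mul_nonneg hx0 hz0
  have hyz := mul_nonneg hy0 hz0
  have k0 := mul_nonneg (show 0 ≤ x ^ 2 + 2 * (x * y) by positivity) (sub_nonneg.2 r0)
  have k2 := mul_nonneg (show 0 ≤ y ^ 2 by positivity) (sub_nonneg.2 r2)
  have k3 := mul_nonneg
    (show 0 ≤ (x + y + z) ^ 2 - (x ^ 2 + 2 * (x * y)) by nlinarith) (sub_nonneg.2 r3)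
  linarith [mul_nonneg hxy (hu 0 1), mul_nonneg hxz (hu 1 3), mul_nonneg hxz (hu 2 3),
    mul_nonneg hyz (hu 2 3), mul_nonneg (sq_nonneg y) (hu 2 3)]

/-- The off-diagonal block of `diag(E)` in another orthonormal basis. -/
lemma block_normSq_le (E : Fin 4 → ℝ) (hE : Monotone E)
    (U : Matrix (Fin 4) (Fin 4) ℂ) (h₁ : Uᴴ * U = 1) (h₂ : U * Uᴴ = 1)
    (A : Matrix (Fin 4) (Fin 4) ℂ)
    (hA : A = Uᴴ * diagonal (fun i => (E i : ℂ)) * U) :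
    normSq (A 0 2) + normSq (A 0 3) + normSq (A 1 2) + normSq (A 1 3)
      ≤ ((E 3 - E 0) ^ 2 + (E 2 - E 1) ^ 2) / 4 := by
  have hDh : (diagonal (fun i => (E i : ℂ))).IsHermitian := by
    apply Matrix.isHermitian_diagonal_of_self_adjoint
    ext i; simp
  have hAh : A.IsHermitian := hA ▸ isHermitian_conjTranspose_mul_mul U hDh
  have e := sum_sq_sub_mul_normSq_conj E ![1, 1, 0, 0] U h₁ h₂
  set L : Matrix (Fin 4) (Fin 4) ℂ := diagonal (fun i => ((![1, 1, 0, 0] i : ℝ) : ℂ)) with hL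
  have hLh : L.IsHermitian := by
    apply Matrix.isHermitian_diagonal_of_self_adjoint
    ext i; simp
  have hLL : L * L = L := by
    rw [hL, Matrix.diagonal_mul_diagonal]
    congr 1
    ext i; fin_cases i <;> simp
  set P := U * L * Uᴴ with hP
  have hPh : P.IsHermitian := isHermitian_mul_mul_conjTranspose U hLh
  have hPP : P * P = P := by
    calc P * P = U * (L * (Uᴴ * U) * L) * Uᴴ := by rw [hP]; simp only [Matrix.mul_assoc]
      _ = P := by rw [h₁, Matrix.mul_one, hLL]
  have r := sum_normSq_row_projection_le P hPh hPP
  have s := normSq_apply_comm hPh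
  have t := normSq_apply_comm hAh
  rw [← hA] at e
  simp [Fin.sum_univ_four] at e
  have r0 := r 0
  have r2 := r 2
  have r3 := r 3
  rw [show Finset.univ.erase (0 : Fin 4) = {1, 2, 3} by decide] at r0
  rw [show Finset.univ.erase (2 : Fin 4) = {0, 1, 3} by decide] at r2
  rw [show Finset.univ.erase (3 : Fin 4) = {0, 1, 2} by decide] at r3
  simp at r0 r2 r3
  rw [s 1 0, s 2 0, s 3 0, s 2 1, s 3 1, s 3 2, t 2 0, t 3 0, t 2 1, t 3 1] at e
  rw [s 2 0, s 2 1] at r2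
  rw [s 3 0, s 3 1, s 3 2] at r3
  have f := fractional_matching_bound E hE (fun i j => normSq (P i j))
    (fun _ _ => normSq_nonneg _) r0 r2 r3
  linarith

/-- The maximal squared speed of a state with given ordered spectrum. -/
lemma sum_sq_sub_mul_normSq_le (l : Fin 4 → ℝ) (hl : Antitone l) (a b : ℝ)
    (u : Fin 4 → Fin 4 → ℝ) (hu : ∀ i j, 0 ≤ u i j) (hs : ∀ i j, u i j = u j i)
    (r0 : u 0 1 + (u 0 2 + u 0 3) ≤ a / 4) (r3 : u 3 0 + (u 3 1 + u 3 2) ≤ a / 4)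
    (hb : u 0 2 + u 0 3 + u 1 2 + u 1 3 ≤ (a + b) / 4) :
    ∑ i, ∑ j, (l i - l j) ^ 2 * u i j
      ≤ (a * (l 0 - l 3) ^ 2 + b * (l 1 - l 2) ^ 2) / 2 := by
  obtain ⟨x, hx⟩ : ∃ x, x = l 0 - l 1 := ⟨_, rfl⟩
  obtain ⟨y, hy⟩ : ∃ y, y = l 1 - l 2 := ⟨_, rfl⟩
  obtain ⟨z, hz⟩ : ∃ z, z = l 2 - l 3 := ⟨_, rfl⟩
  have hx0 : 0 ≤ x := hx ▸ sub_nonneg.2 (hl (by decide))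
  have hy0 : 0 ≤ y := hy ▸ sub_nonneg.2 (hl (by decide))
  have hz0 : 0 ≤ z := hz ▸ sub_nonneg.2 (hl (by decide))
  have l2 : l 2 = l 3 + z := by rw [hz]; ring
  have l1 : l 1 = l 3 + z + y := by rw [hz, hy]; ring
  have l0 : l 0 = l 3 + z + y + x := by rw [hz, hy, hx]; ring
  simp only [Fin.sum_univ_four]
  rw [hs 3 0, hs 3 1, hs 3 2] at r3
  rw [hs 1 0, hs 2 0, hs 3 0, hs 2 1, hs 3 1, hs 3 2, l0, l1, l2]
  have n01 := hu 0 1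
  have n02 := hu 0 2
  have n13 := hu 1 3
  have n23 := hu 2 3
  have hxy := mul_nonneg hx0 hy0
  have hxz := mul_nonneg hx0 hz0
  have hyz := mul_nonneg hy0 hz0
  nlinarith [mul_nonneg (sq_nonneg x) (sub_nonneg.2 r0), mul_nonneg (sq_nonneg z) (sub_nonneg.2 r3),
    mul_nonneg (sq_nonneg y) (sub_nonneg.2 hb), mul_nonneg hxy (sub_nonneg.2 r0),
    mul_nonneg hyz (sub_nonneg.2 r3), mul_nonneg hxz (sub_nonneg.2 r0), mul_nonneg hxy n01,
    mul_nonneg hyz n23, mul_nonneg hxz n01, mul_nonneg hxz n02]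

/-- Optimization of the spectrum at fixed purity `(1 + s ^ 2) / 2`. -/
lemma spectrum_bound (l : Fin 4 → ℝ) (hl0 : ∀ i, 0 ≤ l i) (a b s : ℝ)
    (hb : 0 ≤ b) (hba : b ≤ a) (hs : 0 < s) (hab : a * (1 + s) ≤ b * (1 + 3 * s))
    (hsum : ∑ i, l i = 1) (hsq : ∑ i, l i ^ 2 = (1 + s ^ 2) / 2) :
    a * (l 0 - l 3) ^ 2 + b * (l 1 - l 2) ^ 2
      ≤ ((1 + s) ^ 2 * a + (1 - s) ^ 2 * b) / 4 := by
  simp only [Fin.sum_univ_four] at hsum hsq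
  have n03 := mul_nonneg (hl0 0) (hl0 3)
  have n12 := mul_nonneg (hl0 1) (hl0 2)
  obtain ⟨D, hD⟩ : ∃ D, D = |(l 0 + l 3) - (l 1 + l 2)| := ⟨_, rfl⟩
  have hD0 : 0 ≤ D := hD ▸ abs_nonneg _
  have hDle : (l 0 + l 3) - (l 1 + l 2) ≤ D := hD ▸ le_abs_self _
  have hD2 : D ^ 2 = ((l 0 + l 3) - (l 1 + l 2)) ^ 2 := by rw [hD, sq_abs]
  have hDs : D ^ 2 = s ^ 2 + 4 * (l 0 * l 3 + l 1 * l 2) := by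
    rw [hD2]
    have h := congrArg (· ^ 2) hsum
    linarith
  have hsD : s ≤ D := by
    apply le_of_sq_le_sq _ hD0
    linarith
  have e₁ : a * (l 0 - l 3) ^ 2 + b * (l 1 - l 2) ^ 2
      ≤ a * (1 + D) ^ 2 / 4 + b * (1 - D) ^ 2 / 4 - b * (D ^ 2 - s ^ 2) := by
    have hT : l 0 + l 3 = (1 + ((l 0 + l 3) - (l 1 + l 2))) / 2 := by linarith
    have hS : l 1 + l 2 = (1 - ((l 0 + l 3) - (l 1 + l 2))) / 2 := by linarith
    have hT2 : (l 0 - l 3) ^ 2 = (1 + ((l 0 + l 3) - (l 1 + l 2))) ^ 2 / 4 - 4 * (l 0 * l 3) := by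
      linear_combination ((l 0 + l 3) + (1 + ((l 0 + l 3) - (l 1 + l 2))) / 2) * hT
    have hS2 : (l 1 - l 2) ^ 2 = (1 - ((l 0 + l 3) - (l 1 + l 2))) ^ 2 / 4 - 4 * (l 1 * l 2) := by
      linear_combination ((l 1 + l 2) + (1 - ((l 0 + l 3) - (l 1 + l 2))) / 2) * hS
    rw [hT2, hS2]
    generalize (l 0 + l 3) - (l 1 + l 2) = d at *
    nlinarith [mul_nonneg (sub_nonneg.2 hba) n03, mul_nonneg (sub_nonneg.2 hba)
      (sub_nonneg.2 hDle), congrArg (a * ·) hD2, congrArg (b * ·) hD2, congrArg (b * ·) hDs]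
  have e₂ : a * (2 + (D + s)) ≤ b * (2 + 3 * (D + s)) := by
    have h3 : a ≤ 3 * b := by nlinarith
    nlinarith [mul_nonneg (sub_nonneg.2 h3) (sub_nonneg.2 hsD)]
  nlinarith [mul_nonneg (sub_nonneg.2 hsD) (sub_nonneg.2 e₂)]

/-- An ordered spectral decomposition. -/
lemma exists_ordered_spectral_decomposition {m : ℕ} (A : Matrix (Fin m) (Fin m) ℂ)
    (hA : A.PosSemidef) :
    ∃ (U : Matrix (Fin m) (Fin m) ℂ) (l : Fin m → ℝ), Uᴴ * U = 1 ∧ U * Uᴴ = 1 ∧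
      Antitone l ∧ (∀ i, 0 ≤ l i) ∧ A = U * diagonal (fun i => (l i : ℂ)) * Uᴴ := by
  set ev := hA.isHermitian.eigenvalues with hev
  let e : Equiv.Perm (Fin m) := Tuple.sort (fun i => -ev i)
  have hV := hA.isHermitian.eigenvectorUnitary.2
  set V : Matrix (Fin m) (Fin m) ℂ := ↑hA.isHermitian.eigenvectorUnitary with hVdef
  rw [Matrix.mem_unitaryGroup_iff'] at hV
  have h₁ : (V.submatrix id e)ᴴ * V.submatrix id e = 1 := by
    rw [Matrix.conjTranspose_submatrix, ← Matrix.submatrix_mul _ _ _ id _ Function.bijective_id,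
      ← Matrix.star_eq_conjTranspose, hV, Matrix.submatrix_one_equiv]
  refine ⟨V.submatrix id e, ev ∘ e, h₁, mul_eq_one_comm.1 h₁, ?_,
    fun i => hA.eigenvalues_nonneg _, ?_⟩
  · intro i j hij
    have := Tuple.monotone_sort (fun i => -ev i) hij
    simpa using this
  · have h := hA.isHermitian.spectral_theorem
    rw [Unitary.conjStarAlgAut_apply] at h
    have hd : diagonal (fun i => (((ev ∘ e) i : ℝ) : ℂ))
        = (diagonal (fun i => (ev i : ℂ))).submatrix e e := by
      rw [Matrix.submatrix_diagonal_equiv]; rfl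
    rw [hd, Matrix.conjTranspose_submatrix,
      Matrix.submatrix_mul_equiv, Matrix.submatrix_mul_equiv]
    exact h

/-- The two equatorial states combined into a matrix in the energy basis. -/
lemma optimal_state_apply (α β z w c : ℂ) (hc : star c * c = 1 / 2)
    (hz : z * star z = 1) (hw : w * star w = 1) :
    α • vecMulVec (c • ((Pi.single (0 : Fin 4) 1 : Fin 4 → ℂ)
          + z • (Pi.single (3 : Fin 4) 1 : Fin 4 → ℂ)))
        (star (c • ((Pi.single (0 : Fin 4) 1 : Fin 4 → ℂ)
          + z • (Pi.single (3 : Fin 4) 1 : Fin 4 → ℂ))))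
      + β • vecMulVec (c • ((Pi.single (1 : Fin 4) 1 : Fin 4 → ℂ)
          + w • (Pi.single (2 : Fin 4) 1 : Fin 4 → ℂ)))
        (star (c • ((Pi.single (1 : Fin 4) 1 : Fin 4 → ℂ)
          + w • (Pi.single (2 : Fin 4) 1 : Fin 4 → ℂ))))
      = !![α / 2, 0, 0, α / 2 * star z; 0, β / 2, β / 2 * star w, 0;
          0, β / 2 * w, β / 2, 0; α / 2 * z, 0, 0, α / 2] := by
  ext i j
  fin_cases i <;> fin_cases j <;> simp [vecMulVec_apply] at hc hz hw ⊢
  · linear_combination α * hc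
  · linear_combination α * starRingEnd ℂ z * hc
  · linear_combination β * hc
  · linear_combination β * starRingEnd ℂ w * hc
  · linear_combination β * w * hc
  · linear_combination β * w * starRingEnd ℂ w * hc + β / 2 * hw
  · linear_combination α * z * hc
  · linear_combination α * z * starRingEnd ℂ z * hc + α / 2 * hz

/-- For `d = 4`, `E₁ < E₂ < E₃ < E₄`, `γ₁ = ω₁₄²/ω₂₃² < 2`, and
purity `κ ∈ [κ₂, 1]`, the state
`ρ_κ = ((1+√(2κ−1))/2)|Ψ₁⟩⟨Ψ₁| + ((1−√(2κ−1))/2)|Ψ₂⟩⟨Ψ₂|` is a density matrix of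
purity `κ` with squared speed `((1+√(2κ−1))²ω₁₄² + (1−√(2κ−1))²ω₂₃²)/8`, and it is
optimal among all density matrices of purity `κ`. -/
theorem optimal_state_dim_four_high_purity
    (E : Fin 4 → ℝ) (hE : StrictMono E)
    (ω₁₄ ω₂₃ : ℝ) (hω₁₄ : ω₁₄ = E 3 - E 0) (hω₂₃ : ω₂₃ = E 2 - E 1)
    (γ₁ : ℝ) (hγ₁def : γ₁ = ω₁₄^2 / ω₂₃^2) (hγ₁lt : γ₁ < 2)
    (x₀ κ₁ κ₂ : ℝ)
    (hx₀ : x₀ = (γ₁ - 1) / (4 * (3 - γ₁)))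
    (hκ₁ : κ₁ = 4 * (1/4 + x₀)^2 + 2 * (1/4 - x₀)^2)
    (hκ₂ : κ₂ = κ₁ + 2 * (1/4 - x₀)^2)
    (H : Matrix (Fin 4) (Fin 4) ℂ)
    (hH : H = Matrix.diagonal fun i => (E i : ℂ))
    (κ : ℝ) (hκ : κ ∈ Set.Icc κ₂ 1)
    (θ₁ θ₂ : ℝ)
    (Ψ₁ Ψ₂ : Fin 4 → ℂ)
    (hΨ₁ : Ψ₁ = ((Real.sqrt 2 : ℂ))⁻¹ •
        ((Pi.single (0 : Fin 4) 1 : Fin 4 → ℂ)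
          + Complex.exp (-(θ₁ : ℂ) * Complex.I) • (Pi.single (3 : Fin 4) 1 : Fin 4 → ℂ)))
    (hΨ₂ : Ψ₂ = ((Real.sqrt 2 : ℂ))⁻¹ •
        ((Pi.single (1 : Fin 4) 1 : Fin 4 → ℂ)
          + Complex.exp (-(θ₂ : ℂ) * Complex.I) • (Pi.single (2 : Fin 4) 1 : Fin 4 → ℂ)))
    (ρκ : Matrix (Fin 4) (Fin 4) ℂ)
    (hρκ : ρκ = (((1 + Real.sqrt (2*κ - 1)) / 2 : ℝ) : ℂ) • Matrix.vecMulVec Ψ₁ (star Ψ₁)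
        + (((1 - Real.sqrt (2*κ - 1)) / 2 : ℝ) : ℂ) • Matrix.vecMulVec Ψ₂ (star Ψ₂)) :
    ρκ.PosSemidef ∧ ρκ.trace = 1 ∧ (ρκ * ρκ).trace = (κ : ℂ)
    ∧ -(((H * ρκ - ρκ * H) * (H * ρκ - ρκ * H)).trace)
        = ((((1 + Real.sqrt (2*κ - 1))^2 * ω₁₄^2
            + (1 - Real.sqrt (2*κ - 1))^2 * ω₂₃^2) / 8 : ℝ) : ℂ)
    ∧ (∀ σ : Matrix (Fin 4) (Fin 4) ℂ,
        σ.PosSemidef → σ.trace = 1 → (σ * σ).trace = (κ : ℂ) →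
        (-(((H * σ - σ * H) * (H * σ - σ * H)).trace)).re
          ≤ (-(((H * ρκ - ρκ * H) * (H * ρκ - ρκ * H)).trace)).re) := by
  have h01 : E 0 < E 1 := hE (by decide)
  have h12 : E 1 < E 2 := hE (by decide)
  have h23 : E 2 < E 3 := hE (by decide)
  have hbpos : 0 < ω₂₃ := by rw [hω₂₃]; linarith
  have hlt : ω₂₃ < ω₁₄ := by rw [hω₂₃, hω₁₄]; linarith
  have hb2 : 0 < ω₂₃ ^ 2 := by positivity
  have hba : ω₂₃ ^ 2 < ω₁₄ ^ 2 := by gcongr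
  have hγ1 : 1 < γ₁ := by rw [hγ₁def, one_lt_div hb2]; exact hba
  have hγb : ω₁₄ ^ 2 = γ₁ * ω₂₃ ^ 2 := by rw [hγ₁def, div_mul_cancel₀ _ hb2.ne']
  have hx0pos : 0 < x₀ := by rw [hx₀]; apply div_pos <;> linarith
  have h4x : 4 * x₀ * (3 - γ₁) = γ₁ - 1 := by
    have : 3 - γ₁ ≠ 0 := by linarith
    rw [hx₀]; field_simp
  obtain ⟨hκlo, hκ1⟩ := hκ
  obtain ⟨s, hs⟩ : ∃ s, s = Real.sqrt (2 * κ - 1) := ⟨_, rfl⟩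
  have hκx : (4 * x₀) ^ 2 ≤ 2 * κ - 1 := by rw [hκ₂, hκ₁] at hκlo; linarith
  have hs4 : 4 * x₀ ≤ s := hs ▸ Real.le_sqrt_of_sq_le hκx
  have hspos : 0 < s := by linarith
  have hs1 : s ≤ 1 := by rw [hs, Real.sqrt_le_one]; linarith
  have hs2 : s ^ 2 = 2 * κ - 1 := by
    rw [hs, Real.sq_sqrt (le_trans (sq_nonneg _) hκx)]
  have hκs : κ = (1 + s ^ 2) / 2 := by linarith
  have hcond : ω₁₄ ^ 2 * (1 + s) ≤ ω₂₃ ^ 2 * (1 + 3 * s) := by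
    have : γ₁ * (1 + s) ≤ 1 + 3 * s := by nlinarith
    rw [hγb]; nlinarith
  rw [← hs] at hρκ ⊢
  have hunit : ∀ θ : ℝ, cexp (-(θ : ℂ) * I) * star (cexp (-(θ : ℂ) * I)) = 1 := by
    intro θ
    rw [Complex.star_def, ← Complex.exp_conj, ← Complex.exp_add]
    simp
  have hc : star ((Real.sqrt 2 : ℂ))⁻¹ * ((Real.sqrt 2 : ℂ))⁻¹ = 1 / 2 := by
    rw [Complex.star_def, map_inv₀, Complex.conj_ofReal, ← mul_inv, ← Complex.ofReal_mul,
      Real.mul_self_sqrt (by norm_num)]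
    norm_num
  have hpsd : ρκ.PosSemidef := by
    rw [hρκ]
    refine Matrix.PosSemidef.add ?_ ?_
    · refine (Matrix.posSemidef_vecMulVec_self_star Ψ₁).smul ?_
      rw [Complex.zero_le_real]; linarith
    · refine (Matrix.posSemidef_vecMulVec_self_star Ψ₂).smul ?_
      rw [Complex.zero_le_real]; linarith
  have hz := hunit θ₁
  have hw := hunit θ₂
  rw [hΨ₁, hΨ₂, optimal_state_apply _ _ _ _ _ hc hz hw] at hρκ
  generalize cexp (-(θ₁ : ℂ) * I) = z at *
  generalize cexp (-(θ₂ : ℂ) * I) = w at *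
  have hz' : normSq z = 1 := by
    rw [← Complex.ofReal_inj, ← Complex.mul_conj]; exact_mod_cast hz
  have hw' : normSq w = 1 := by
    rw [← Complex.ofReal_inj, ← Complex.mul_conj]; exact_mod_cast hw
  have hspeed : ∀ σ : Matrix (Fin 4) (Fin 4) ℂ, σ.IsHermitian →
      -(((H * σ - σ * H) * (H * σ - σ * H)).trace)
        = ((∑ i, ∑ j, (E i - E j) ^ 2 * normSq (σ i j) : ℝ) : ℂ) := by
    intro σ hσ
    rw [← neg_trace_commutator_diagonal_sq E σ hσ, ← hH, ← neg_sub (σ * H), neg_mul_neg]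
  have hval : -(((H * ρκ - ρκ * H) * (H * ρκ - ρκ * H)).trace)
      = ((((1 + s) ^ 2 * ω₁₄ ^ 2 + (1 - s) ^ 2 * ω₂₃ ^ 2) / 8 : ℝ) : ℂ) := by
    rw [hspeed _ hpsd.isHermitian, Complex.ofReal_inj, hρκ, hω₁₄, hω₂₃]
    have hn : ∀ x : ℝ, normSq ((x : ℂ) / 2) = x ^ 2 / 4 := by
      intro x
      rw [normSq_div, normSq_ofReal, show (2 : ℂ) = ((2 : ℝ) : ℂ) by norm_num, normSq_ofReal]
      ring
    simp only [Fin.sum_univ_four, Matrix.of_apply, Matrix.cons_val, normSq_mul, hn,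
      Complex.star_def, normSq_conj, hz', hw', normSq_zero]
    ring
  refine ⟨hpsd, ?_, ?_, hval, ?_⟩
  · rw [hρκ]
    simp [Matrix.trace, Fin.sum_univ_four]
    ring
  · rw [hρκ, hκs]
    simp [Matrix.trace, Fin.sum_univ_four] at hz hw ⊢
    linear_combination (1 + (s : ℂ)) ^ 2 / 8 * hz + (1 - (s : ℂ)) ^ 2 / 8 * hw
  · intro σ hσ htr hpur
    rw [hval, hspeed σ hσ.isHermitian, Complex.ofReal_re, Complex.ofReal_re]
    obtain ⟨U, l, h₁, h₂, hl, hl0, rfl⟩ := exists_ordered_spectral_decomposition σ hσ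
    have hsum : ∑ i, l i = 1 := by
      rw [Matrix.trace_mul_comm, ← Matrix.mul_assoc, h₁, Matrix.one_mul,
        Matrix.trace_diagonal] at htr
      exact_mod_cast htr
    have hsq : ∑ i, l i ^ 2 = (1 + s ^ 2) / 2 := by
      have : U * diagonal (fun i => (l i : ℂ)) * Uᴴ * (U * diagonal (fun i => (l i : ℂ)) * Uᴴ)
          = U * (diagonal (fun i => (l i : ℂ)) * (Uᴴ * U) * diagonal (fun i => (l i : ℂ)))
            * Uᴴ := by simp only [Matrix.mul_assoc]
      rw [this, h₁, Matrix.mul_one, Matrix.trace_mul_comm, ← Matrix.mul_assoc, h₁,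
        Matrix.one_mul, Matrix.diagonal_mul_diagonal, Matrix.trace_diagonal, hκs] at hpur
      simp only [sq (l _)]
      exact_mod_cast hpur
    rw [sum_sq_sub_mul_normSq_conj E l U h₁ h₂]
    have hlo : ∀ i, E 0 ≤ E i := fun i => hE.monotone (Fin.zero_le i)
    have hhi : ∀ i, E i ≤ E 3 := fun i => hE.monotone (Fin.le_last i)
    have r0 := sum_normSq_row_sub_le E _ _ hlo hhi U h₁ h₂ 0
    have r3 := sum_normSq_row_sub_le E _ _ hlo hhi U h₁ h₂ 3
    have hblock := block_normSq_le E hE.monotone U h₁ h₂ _ rfl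
    have hAh : (Uᴴ * diagonal (fun i => (E i : ℂ)) * U).IsHermitian := by
      apply isHermitian_conjTranspose_mul_mul
      apply Matrix.isHermitian_diagonal_of_self_adjoint
      ext i; simp
    rw [show Finset.univ.erase (0 : Fin 4) = {1, 2, 3} by decide, ← hω₁₄,
      Finset.sum_insert (by decide), Finset.sum_pair (by decide)] at r0
    rw [show Finset.univ.erase (3 : Fin 4) = {0, 1, 2} by decide, ← hω₁₄,
      Finset.sum_insert (by decide), Finset.sum_pair (by decide)] at r3
    rw [← hω₁₄, ← hω₂₃] at hblock
    have f₁ := sum_sq_sub_mul_normSq_le l hl (ω₁₄ ^ 2) (ω₂₃ ^ 2)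
      (fun i j => normSq ((Uᴴ * diagonal (fun i => (E i : ℂ)) * U) i j))
      (fun _ _ => normSq_nonneg _) (normSq_apply_comm hAh) r0 r3 hblock
    have f₂ := spectrum_bound l hl0 (ω₁₄ ^ 2) (ω₂₃ ^ 2) s hb2.le hba.le hspos hcond hsum hsq
    linarith
end
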